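/- arXiv:0907.0991 — 2 statements merged into one kernel-verified Lean document; each statement's English description precedes it below -/
import Mathlib

section
/- Let μ ∈ 𝓜 and let (μ̃_n) be a sequence in 𝓜 with μ̃_n → μ in L²(Ω) as n → ∞. Then λ₁[μ̃_n] → λ₁[μ] as n → ∞, where for ρ ∈ 𝓜 the principal eigenvalue λ₁[ρ] is defined by the Rayleigh formula λ₁[ρ] = inf { (∫_Ω D|∇ψ(x)|² − ρ(x)ψ(x)² dx) / (∫_Ω ψ(x)² dx) : ψ a smooth compactly supported function on Ω, ψ not identically zero }. -/
open MeasureTheory Real Set Filter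

noncomputable def lap {d : ℕ} (f : EuclideanSpace ℝ (Fin d) → ℝ)
    (x : EuclideanSpace ℝ (Fin d)) : ℝ :=
  ∑ i : Fin d, fderiv ℝ (fun y => fderiv ℝ f y (EuclideanSpace.single i 1)) x
    (EuclideanSpace.single i 1)

/-- The class `𝓜` of habitat configurations. -/
def MemM {d : ℕ} (Ω Ω₁ : Set (EuclideanSpace ℝ (Fin d))) (m M : ℝ)
    (μ : EuclideanSpace ℝ (Fin d) → ℝ) : Prop :=
  Measurable μ ∧ (∀ᵐ x ∂(volume : Measure (EuclideanSpace ℝ (Fin d))),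
    x ∈ Ω → -M ≤ μ x ∧ μ x ≤ M) ∧
  (∀ᵐ x ∂(volume : Measure (EuclideanSpace ℝ (Fin d))), x ∈ Ω \ Ω₁ → μ x = m)

/-- The class `𝓓(ū, u̲)` of admissible initial data. -/
def MemD {d : ℕ} (Ω Bε : Set (EuclideanSpace ℝ (Fin d))) (ubar lbar : ℝ)
    (φ : EuclideanSpace ℝ (Fin d) → ℝ) : Prop :=
  ContDiff ℝ 2 φ ∧ (∀ x ∈ closure Ω, 0 ≤ φ x) ∧
  (∀ x ∈ closure Ω, |φ x| ≤ ubar ∧ ‖fderiv ℝ φ x‖ ≤ ubar ∧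
    ‖fderiv ℝ (fderiv ℝ φ) x‖ ≤ ubar) ∧
  (∀ x ∈ Bε, lbar ≤ φ x)

/-- Classical solution of `(P_{μ,γ})` with initial datum `ui`. -/
def IsSol {d : ℕ} (Ω : Set (EuclideanSpace ℝ (Fin d))) (D γ : ℝ)
    (μ ui : EuclideanSpace ℝ (Fin d) → ℝ)
    (u : ℝ → EuclideanSpace ℝ (Fin d) → ℝ) : Prop :=
  ContinuousOn (fun p : ℝ × EuclideanSpace ℝ (Fin d) => u p.1 p.2)
    (Ici (0:ℝ) ×ˢ closure Ω) ∧
  (∀ t > (0:ℝ), ∀ x ∈ Ω, DifferentiableAt ℝ (fun s => u s x) t) ∧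
  (∀ t > (0:ℝ), ∀ x ∈ Ω, ContDiffAt ℝ 2 (u t) x) ∧
  (∀ t > (0:ℝ), ∀ x ∈ Ω,
    deriv (fun s => u s x) t = D * lap (u t) x + u t x * (μ x - γ * u t x)) ∧
  (∀ t > (0:ℝ), ∀ x ∈ frontier Ω, u t x = 0) ∧
  (∀ x ∈ closure Ω, u 0 x = ui x)

/-- The principal Dirichlet eigenvalue `λ₁[ρ]` of `ψ ↦ -DΔψ - ρψ` on `Ω`, defined through
the Rayleigh quotient over nonzero smooth compactly supported test functions. -/
noncomputable def lambda1 {d : ℕ} (Ω : Set (EuclideanSpace ℝ (Fin d))) (D : ℝ)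
    (ρ : EuclideanSpace ℝ (Fin d) → ℝ) : ℝ :=
  sInf { r : ℝ | ∃ ψ : EuclideanSpace ℝ (Fin d) → ℝ,
    ContDiff ℝ (⊤ : ℕ∞) ψ ∧ HasCompactSupport ψ ∧ tsupport ψ ⊆ Ω ∧ ψ ≠ 0 ∧
    r = (∫ x in Ω, (D * ‖gradient ψ x‖^2 - ρ x * (ψ x)^2)) / (∫ x in Ω, (ψ x)^2) }

lemma aux_sob {d : ℕ} (hd : 1 ≤ d) : ∃ (C : NNReal) (p : ENNReal), ENNReal.HolderConjugate (d : ENNReal) p ∧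
    ∀ u : EuclideanSpace ℝ (Fin d) → ℝ, ContDiff ℝ 1 u → HasCompactSupport u →
      eLpNorm u p volume ≤ C * eLpNorm (fderiv ℝ u) 1 volume := by
  rcases Nat.eq_or_lt_of_le hd with h1 | h1
  · subst h1
    refine ⟨1, ⊤, by simp only [Nat.cast_one]; infer_instance, fun u hu hc => ?_⟩
    let e : ℝ ≃ₗᵢ[ℝ] EuclideanSpace ℝ (Fin 1) := (OrthonormalBasis.singleton (Fin 1) ℝ).repr
    have key : ∀ x, ‖u x‖ₑ ≤ eLpNorm (fderiv ℝ u) 1 volume := by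
      intro x
      have h := HasCompactSupport.enorm_le_lintegral_Ici_deriv (f := u ∘ e)
        (hu.comp e.toContinuousLinearEquiv.contDiff)
        (hc.comp_homeomorph e.toHomeomorph) (e.symm x)
      rw [eLpNorm_one_eq_lintegral_enorm, ← e.measurePreserving.lintegral_comp_emb
        e.toHomeomorph.measurableEmbedding]
      simp only [Function.comp, LinearIsometryEquiv.apply_symm_apply] at h
      refine h.trans ((setLIntegral_le_lintegral _ _).trans (lintegral_mono fun y => ?_))
      have hd1 : HasDerivAt (u ∘ e) (fderiv ℝ u (e y) (e 1)) y := by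
        have h2 : HasFDerivAt (fun y : ℝ => e y)
          (e.toContinuousLinearEquiv : ℝ →L[ℝ] EuclideanSpace ℝ (Fin 1)) y :=
          e.toContinuousLinearEquiv.hasFDerivAt
        have h3 := ((hu.differentiable (by norm_num)) (e y)).hasFDerivAt.comp y h2
        simpa using! h3.hasDerivAt
      rw [hd1.deriv, ← ofReal_norm, ← ofReal_norm]
      apply ENNReal.ofReal_le_ofReal
      have := (fderiv ℝ u (e y)).le_opNorm (e 1)
      simpa using this
    rw [eLpNorm_exponent_top, ENNReal.coe_one, one_mul]
    exact eLpNormEssSup_le_of_ae_enorm_bound (Eventually.of_forall key)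
  · have h2 : (1 : NNReal) < (d : NNReal) := by exact_mod_cast h1
    have hp := NNReal.HolderConjugate.conjExponent h2
    refine ⟨_, (NNReal.conjExponent (d : NNReal) : NNReal), by simpa using hp.coe_ennreal,
      fun u hu hc => eLpNorm_le_eLpNorm_fderiv_one volume hu hc (by simpa using hp)⟩

lemma aux_conv {α : Type*} [MeasurableSpace α] (ν : Measure α) [IsFiniteMeasure ν] (d : ℕ)
    (hd : 1 ≤ d) (K : ℝ) (w : ℕ → α → ℝ) (hw : ∀ n, Measurable (w n))
    (hK : ∀ n, ∀ᵐ x ∂ν, |w n x| ≤ K)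
    (hc : Tendsto (fun n => ∫ x, (w n x)^2 ∂ν) atTop (nhds 0)) :
    Tendsto (fun n => eLpNorm (w n) d ν) atTop (nhds 0) := by
  have hmem : ∀ n (p : ENNReal), MemLp (w n) p ν := fun n p =>
    MemLp.of_bound (hw n).aestronglyMeasurable K (by simpa using hK n)
  have main : ∀ k : ℕ, Tendsto (fun n => eLpNorm (w n) ((k + 2 : ℕ) : ENNReal) ν) atTop (nhds 0) := by
    intro k
    have e1 : ∀ n, eLpNorm (w n) ((k + 2 : ℕ) : ENNReal) ν
        = ENNReal.ofReal ((∫ a, |w n a| ^ (k+2) ∂ν) ^ (((k + 2 : ℕ) : ℝ)⁻¹)) := by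
      intro n
      rw [(hmem n _).eLpNorm_eq_integral_rpow_norm (by simp) (ENNReal.natCast_ne_top _)]
      simp only [ENNReal.toReal_natCast, Real.rpow_natCast, Real.norm_eq_abs]
    have h2 : Tendsto (fun n => ∫ a, |w n a| ^ (k+2) ∂ν) atTop (nhds 0) := by
      refine squeeze_zero (fun n => integral_nonneg fun a => by positivity) (fun n => ?_)
        (by simpa using hc.const_mul (K^k))
      rw [← integral_const_mul]
      refine integral_mono_ae ?_ ?_ ?_
      · have := (hmem n ((k+2 : ℕ) : ENNReal)).integrable_norm_pow (by simp)
        simpa using this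
      · exact ((hmem n 2).integrable_sq).const_mul _
      · filter_upwards [hK n] with a ha
        rw [pow_add, sq_abs]
        gcongr
    simp_rw [e1]
    have h3 := h2.rpow_const (p := ((k + 2 : ℕ) : ℝ)⁻¹) (Or.inr (by positivity))
    rw [Real.zero_rpow (by positivity)] at h3
    simpa using ENNReal.tendsto_ofReal h3
  rcases Nat.eq_or_lt_of_le hd with h1 | h1
  · subst h1
    have h0 := main 0
    have h1 : Tendsto (fun n => eLpNorm (w n) 2 ν *
        ν Set.univ ^ (1 / (1:ENNReal).toReal - 1 / (2:ENNReal).toReal)) atTop (nhds 0) := by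
      have := ENNReal.Tendsto.mul_const (b := ν Set.univ ^ (1 / (1:ENNReal).toReal - 1 / (2:ENNReal).toReal)) h0 (Or.inr (by
        apply ENNReal.rpow_ne_top_of_nonneg (by norm_num) (measure_ne_top _ _)))
      simpa using this
    refine tendsto_of_tendsto_of_tendsto_of_le_of_le tendsto_const_nhds h1 (fun _ => zero_le) (fun n => ?_)
    simpa using eLpNorm_le_eLpNorm_mul_rpow_measure_univ (μ := ν) (p := 1) (q := 2) (by norm_num)
      (hw n).aestronglyMeasurable
  · obtain ⟨k, rfl⟩ := Nat.exists_eq_add_of_le' h1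
    exact main k

lemma hcs {E : Type*} [TopologicalSpace E] {ψ : E → ℝ} (hc : HasCompactSupport ψ) :
    HasCompactSupport (fun x => (ψ x)^2) :=
  hc.comp_left (g := fun y : ℝ => y^2) (by simp)

lemma ctsq {E : Type*} [TopologicalSpace E] {ψ : E → ℝ} (hc : Continuous ψ) :
    Continuous (fun x => (ψ x)^2) := by fun_prop

lemma intsq {d : ℕ} {ψ : EuclideanSpace ℝ (Fin d) → ℝ} (h : Continuous ψ)
    (hc : HasCompactSupport ψ) : Integrable (fun x => (ψ x)^2) volume :=
  (ctsq h).integrable_of_hasCompactSupport (hcs hc)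

lemma intgsq {d : ℕ} {ψ : EuclideanSpace ℝ (Fin d) → ℝ} (h : ContDiff ℝ 1 ψ)
    (hc : HasCompactSupport ψ) : Integrable (fun x => ‖fderiv ℝ ψ x‖^2) volume :=
  intsq (ψ := fun x => ‖fderiv ℝ ψ x‖) (h.continuous_fderiv (by norm_num)).norm (hc.fderiv ℝ).norm

lemma norm_grad {d : ℕ} (ψ : EuclideanSpace ℝ (Fin d) → ℝ) (x : EuclideanSpace ℝ (Fin d)) :
    ‖gradient ψ x‖ = ‖fderiv ℝ ψ x‖ := by
  simp [gradient]

set_option maxHeartbeats 400000 in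
lemma aux_key {d : ℕ} (Ω : Set (EuclideanSpace ℝ (Fin d))) (C : NNReal) (p : ENNReal)
    (hp : ENNReal.HolderConjugate (d : ENNReal) p)
    (hC : ∀ u : EuclideanSpace ℝ (Fin d) → ℝ, ContDiff ℝ 1 u → HasCompactSupport u →
      eLpNorm u p volume ≤ C * eLpNorm (fderiv ℝ u) 1 volume)
    (w ψ : EuclideanSpace ℝ (Fin d) → ℝ) (hw : Measurable w)
    (hwf : eLpNorm w d (volume.restrict Ω) ≠ ⊤)
    (hψ : ContDiff ℝ 1 ψ) (hc : HasCompactSupport ψ) (hs : tsupport ψ ⊆ Ω) :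
    |∫ x in Ω, w x * (ψ x)^2| ≤ (C * eLpNorm w d (volume.restrict Ω)).toReal *
      ((∫ x in Ω, (ψ x)^2) + ∫ x in Ω, ‖gradient ψ x‖^2) := by
  have hf : Continuous (fderiv ℝ ψ) := hψ.continuous_fderiv (by norm_num)
  have hcf : HasCompactSupport (fderiv ℝ ψ) := hc.fderiv ℝ
  have i1 : Integrable (fun x => (ψ x)^2) volume := intsq hψ.continuous hc
  have i2 : Integrable (fun x => ‖fderiv ℝ ψ x‖^2) volume := intgsq hψ hc
  have e1 : ∫ x in Ω, (ψ x)^2 = ∫ x, (ψ x)^2 := by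
    apply setIntegral_eq_integral_of_forall_compl_eq_zero
    intro x hx
    have : ψ x = 0 := image_eq_zero_of_notMem_tsupport fun h => hx (hs h)
    simp [this]
  have e2 : ∫ x in Ω, ‖gradient ψ x‖^2 = ∫ x, ‖fderiv ℝ ψ x‖^2 := by
    simp_rw [norm_grad]
    apply setIntegral_eq_integral_of_forall_compl_eq_zero
    intro x hx
    have : fderiv ℝ ψ x = 0 := image_eq_zero_of_notMem_tsupport fun h =>
      hx (hs (tsupport_fderiv_subset ℝ h))
    simp [this]
  rw [e1, e2, ← integral_add i1 i2]
  have hu := hC (fun x => (ψ x)^2) (by fun_prop) (hcs hc)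
  have hfd : eLpNorm (fderiv ℝ fun x => (ψ x)^2) 1 volume ≤
      ENNReal.ofReal (∫ x, ((ψ x)^2 + ‖fderiv ℝ ψ x‖^2)) := by
    rw [eLpNorm_one_eq_lintegral_enorm, ofReal_integral_eq_lintegral_ofReal
      (f := fun x => (ψ x)^2 + ‖fderiv ℝ ψ x‖^2) (i1.add i2) (Eventually.of_forall fun x => by positivity)]
    refine lintegral_mono fun x => ?_
    rw [← ofReal_norm]
    apply ENNReal.ofReal_le_ofReal
    have h3 : HasFDerivAt (fun x => (ψ x)^2) _ x := ((hψ.differentiable (by norm_num)) x).hasFDerivAt.pow 2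
    rw [h3.fderiv, norm_smul]
    simp only [Nat.cast_ofNat, Nat.add_one_sub_one, pow_one, norm_mul, Real.norm_eq_abs, nsmul_eq_mul, abs_mul]
    rw [show |(2:ℝ)| = 2 by norm_num, ← sq_abs (ψ x)]
    nlinarith [sq_nonneg (|ψ x| - ‖fderiv ℝ ψ x‖)]
  have hh : ‖∫ x in Ω, w x * (ψ x)^2‖ₑ ≤ (C * eLpNorm w d (volume.restrict Ω)) *
      ENNReal.ofReal (∫ x, ((ψ x)^2 + ‖fderiv ℝ ψ x‖^2)) := by
    calc ‖∫ x in Ω, w x * (ψ x)^2‖ₑ ≤ ∫⁻ x in Ω, ‖w x * (ψ x)^2‖ₑ := enorm_integral_le_lintegral_enorm _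
      _ = eLpNorm (w • fun x => (ψ x)^2) 1 (volume.restrict Ω) := by
        rw [eLpNorm_one_eq_lintegral_enorm]; rfl
      _ ≤ eLpNorm w d (volume.restrict Ω) * eLpNorm (fun x => (ψ x)^2) p (volume.restrict Ω) :=
        eLpNorm_smul_le_mul_eLpNorm (ctsq hψ.continuous).aestronglyMeasurable hw.aestronglyMeasurable
      _ ≤ eLpNorm w d (volume.restrict Ω) * (C * ENNReal.ofReal (∫ x, ((ψ x)^2 + ‖fderiv ℝ ψ x‖^2))) := by
        gcongr
        exact (eLpNorm_mono_measure _ Measure.restrict_le_self).trans (hu.trans (by gcongr))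
      _ = _ := by ring
  have h4 := ENNReal.toReal_mono (ENNReal.mul_ne_top (ENNReal.mul_ne_top ENNReal.coe_ne_top hwf)
    ENNReal.ofReal_ne_top) hh
  rw [ENNReal.toReal_mul, ENNReal.toReal_ofReal (integral_nonneg fun x => by positivity)] at h4
  simpa using h4

set_option maxHeartbeats 400000 in
lemma aux_cmp {d : ℕ} (Ω Ω₁ : Set (EuclideanSpace ℝ (Fin d)))
    (hΩo : IsOpen Ω) (hΩne : Ω.Nonempty)
    (D m M : ℝ) (hD : 0 < D) (a : ℝ) (ha : 0 ≤ a)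
    (μ ν : EuclideanSpace ℝ (Fin d) → ℝ) (hμ : MemM Ω Ω₁ m M μ) (hν : MemM Ω Ω₁ m M ν)
    (hk : ∀ ψ : EuclideanSpace ℝ (Fin d) → ℝ, ContDiff ℝ 1 ψ → HasCompactSupport ψ →
      tsupport ψ ⊆ Ω → |∫ x in Ω, (ν x - μ x) * (ψ x)^2| ≤ a *
      ((∫ x in Ω, (ψ x)^2) + ∫ x in Ω, ‖gradient ψ x‖^2)) :
    lambda1 Ω D ν ≤ lambda1 Ω D μ + a * (1 + (lambda1 Ω D μ + M) / D) := by
  have basic : ∀ ρ : EuclideanSpace ℝ (Fin d) → ℝ, MemM Ω Ω₁ m M ρ →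
      ∀ ψ : EuclideanSpace ℝ (Fin d) → ℝ, ContDiff ℝ 1 ψ → HasCompactSupport ψ →
      IntegrableOn (fun x => ρ x * (ψ x)^2) Ω ∧
      ∫ x in Ω, (D * ‖gradient ψ x‖^2 - ρ x * (ψ x)^2) =
        D * (∫ x in Ω, ‖gradient ψ x‖^2) - ∫ x in Ω, ρ x * (ψ x)^2 ∧
      ∫ x in Ω, ρ x * (ψ x)^2 ≤ M * ∫ x in Ω, (ψ x)^2 := by
    intro ρ hρ ψ hψ hc
    have hf : Continuous (fderiv ℝ ψ) := hψ.continuous_fderiv (by norm_num)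
    have hcf : HasCompactSupport (fderiv ℝ ψ) := hc.fderiv ℝ
    have i1 : Integrable (fun x => (ψ x)^2) volume := intsq hψ.continuous hc
    have i2 : Integrable (fun x => ‖gradient ψ x‖^2) volume := by
      simp_rw [norm_grad]
      exact intgsq hψ hc
    have hb : ∀ᵐ x ∂(volume.restrict Ω), -M ≤ ρ x ∧ ρ x ≤ M :=
      (ae_restrict_iff' hΩo.measurableSet).2 hρ.2.1
    have i3 : IntegrableOn (fun x => ρ x * (ψ x)^2) Ω := by
      refine i1.integrableOn.bdd_mul hρ.1.aestronglyMeasurable (c := M) ?_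
      filter_upwards [hb] with x hx
      exact abs_le.2 hx
    refine ⟨i3, ?_, ?_⟩
    · rw [integral_sub (i2.integrableOn.const_mul D) i3, integral_const_mul]
    · rw [← integral_const_mul]
      refine integral_mono_ae i3 (i1.integrableOn.const_mul M) ?_
      filter_upwards [hb] with x hx
      exact mul_le_mul_of_nonneg_right hx.2 (sq_nonneg _)
  have pos : ∀ ψ : EuclideanSpace ℝ (Fin d) → ℝ, ContDiff ℝ 1 ψ → HasCompactSupport ψ →
      tsupport ψ ⊆ Ω → ψ ≠ 0 → 0 < ∫ x in Ω, (ψ x)^2 := by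
    intro ψ hψ hc hs h0
    rw [setIntegral_eq_integral_of_forall_compl_eq_zero]
    · obtain ⟨x, hx⟩ := Function.ne_iff.1 h0
      exact (ctsq hψ.continuous).integral_pos_of_hasCompactSupport_nonneg_nonzero
        (hcs hc) (fun x => sq_nonneg _)
        (x := x) (by simpa using hx)
    · intro x hx
      have : ψ x = 0 := image_eq_zero_of_notMem_tsupport fun h => hx (hs h)
      simp [this]
  have hDa : 0 < 1 + a / D := by positivity
  suffices h : (lambda1 Ω D ν - a * (1 + M / D)) / (1 + a / D) ≤ lambda1 Ω D μ by
    rw [div_le_iff₀ hDa] at h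
    have : a * (1 + (lambda1 Ω D μ + M) / D) = a * (1 + M / D) + lambda1 Ω D μ * (a / D) := by ring
    linarith
  conv_rhs => rw [lambda1]
  apply le_csInf
  · obtain ⟨x, hx⟩ := hΩne
    obtain ⟨f, h1, h2, h3, -, h5⟩ :=
      exists_contDiff_tsupport_subset (n := ⊤) (hΩo.mem_nhds hx)
    exact ⟨_, f, h3, h2, h1, fun h => by simp [h] at h5, rfl⟩
  · rintro r ⟨ψ, hψ, hc, hs, h0, rfl⟩
    have hψ1 : ContDiff ℝ 1 ψ := hψ.of_le (by exact_mod_cast le_top)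
    obtain ⟨j1, q1, b1⟩ := basic μ hμ ψ hψ1 hc
    obtain ⟨j2, q2, b2⟩ := basic ν hν ψ hψ1 hc
    have hN := pos ψ hψ1 hc hs h0
    have hkk := hk ψ hψ1 hc hs
    have hle : lambda1 Ω D ν ≤ (∫ x in Ω, (D * ‖gradient ψ x‖^2 - ν x * (ψ x)^2)) / (∫ x in Ω, (ψ x)^2) := by
      refine csInf_le ⟨-M, ?_⟩ ⟨ψ, hψ, hc, hs, h0, rfl⟩
      rintro r ⟨φ, gφ, gc, gs, g0, rfl⟩
      have gφ1 : ContDiff ℝ 1 φ := gφ.of_le (by exact_mod_cast le_top)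
      obtain ⟨-, q3, b3⟩ := basic ν hν φ gφ1 gc
      rw [le_div_iff₀ (pos φ gφ1 gc gs g0), q3]
      have : 0 ≤ D * ∫ x in Ω, ‖gradient φ x‖^2 :=
        mul_nonneg hD.le (integral_nonneg fun x => by positivity)
      linarith
    have hsub : ∫ x in Ω, (ν x - μ x) * (ψ x)^2 = (∫ x in Ω, ν x * (ψ x)^2) - ∫ x in Ω, μ x * (ψ x)^2 := by
      rw [← integral_sub j2 j1]
      simp_rw [sub_mul]
    rw [hsub] at hkk
    rw [q2] at hle
    rw [q1]
    generalize (∫ x in Ω, (ψ x)^2) = N at *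
    generalize (∫ x in Ω, ‖gradient ψ x‖^2) = G at *
    generalize (∫ x in Ω, ν x * (ψ x)^2) = A at *
    generalize (∫ x in Ω, μ x * (ψ x)^2) = B at *
    rw [le_div_iff₀ hN] at hle
    rw [div_le_div_iff₀ hDa hN]
    have h6 := (abs_le.1 hkk).1
    have h7 : a * G ≤ a / D * ((D * G - B) + M * N) := by
      have : a * G = a / D * (D * G) := by field_simp
      rw [this]
      apply mul_le_mul_of_nonneg_left _ (by positivity)
      linarith
    have h8 : a * (1 + M / D) * N = a * N + a / D * (M * N) := by ring
    nlinarith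

/-- Proposition 1(b): if `μ̃_n → μ` in `L²(Ω)`, then `λ₁[μ̃_n] → λ₁[μ]`. -/
theorem stmt_4 {d : ℕ} (hd : 1 ≤ d)
    (Ω Ω₁ : Set (EuclideanSpace ℝ (Fin d)))
    (hΩo : IsOpen Ω) (hΩb : Bornology.IsBounded Ω) (hΩne : Ω.Nonempty)
    (hΩ₁ : IsCompact Ω₁) (hΩ₁Ω : Ω₁ ⊆ Ω)
    (D m M : ℝ) (hD : 0 < D) (hM : 0 < M)
    (μ : EuclideanSpace ℝ (Fin d) → ℝ) (hμ : MemM Ω Ω₁ m M μ)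
    (μs : ℕ → EuclideanSpace ℝ (Fin d) → ℝ) (hμs : ∀ n, MemM Ω Ω₁ m M (μs n))
    (hconv : Tendsto (fun n => ∫ x in Ω, (μs n x - μ x)^2) atTop (nhds 0)) :
    Tendsto (fun n => lambda1 Ω D (μs n)) atTop (nhds (lambda1 Ω D μ)) := by
  obtain ⟨C, p, hp, hC⟩ := aux_sob hd
  have hfin : IsFiniteMeasure (volume.restrict Ω) := ⟨by simpa using hΩb.measure_lt_top⟩
  have hmeas : ∀ n, Measurable (fun x => μs n x - μ x) := fun n => (hμs n).1.sub hμ.1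
  have hbd : ∀ n, ∀ᵐ x ∂(volume.restrict Ω), |μs n x - μ x| ≤ 2 * M := by
    intro n
    filter_upwards [(ae_restrict_iff' hΩo.measurableSet).2 hμ.2.1,
      (ae_restrict_iff' hΩo.measurableSet).2 (hμs n).2.1] with x h1 h2
    rw [abs_le]
    constructor <;> linarith [h1.1, h1.2, h2.1, h2.2]
  have ht := aux_conv (volume.restrict Ω) d hd (2 * M) (fun n x => μs n x - μ x) hmeas hbd hconv
  have hne : ∀ n, eLpNorm (fun x => μs n x - μ x) d (volume.restrict Ω) ≠ ⊤ := fun n =>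
    (MemLp.of_bound (hmeas n).aestronglyMeasurable (2 * M) (by simpa using hbd n)).2.ne
  set a : ℕ → ℝ := fun n =>
    (C * eLpNorm (fun x => μs n x - μ x) d (volume.restrict Ω)).toReal with ha
  have ha0 : ∀ n, 0 ≤ a n := fun n => ENNReal.toReal_nonneg
  have hat : Tendsto a atTop (nhds 0) := by
    have h1 := ENNReal.Tendsto.const_mul (a := (C : ENNReal)) ht (Or.inr ENNReal.coe_ne_top)
    rw [mul_zero] at h1
    exact (ENNReal.tendsto_toReal ENNReal.zero_ne_top).comp h1
  have hk1 := fun n ψ (h1 : ContDiff ℝ 1 ψ) (h2 : HasCompactSupport ψ) (h3 : tsupport ψ ⊆ Ω) =>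
    aux_key Ω C p hp hC (fun x => μs n x - μ x) ψ (hmeas n) (hne n) h1 h2 h3
  have up : ∀ n, lambda1 Ω D (μs n) ≤
      lambda1 Ω D μ + a n * (1 + (lambda1 Ω D μ + M) / D) := fun n =>
    aux_cmp Ω Ω₁ hΩo hΩne D m M hD (a n) (ha0 n) μ (μs n) hμ (hμs n) (hk1 n)
  have lo : ∀ n, lambda1 Ω D μ ≤
      lambda1 Ω D (μs n) + a n * (1 + (lambda1 Ω D (μs n) + M) / D) := fun n =>
    aux_cmp Ω Ω₁ hΩo hΩne D m M hD (a n) (ha0 n) (μs n) μ (hμs n) hμ (by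
      intro ψ h1 h2 h3
      have h4 := hk1 n ψ h1 h2 h3
      have h5 : ∫ x in Ω, (μ x - μs n x) * (ψ x)^2 = - ∫ x in Ω, (μs n x - μ x) * (ψ x)^2 := by
        rw [← integral_neg]
        congr 1
        ext x
        ring
      rw [h5, abs_neg]
      exact h4)
  have lo2 : ∀ n, (lambda1 Ω D μ - a n * (1 + M / D)) / (1 + a n / D) ≤ lambda1 Ω D (μs n) := by
    intro n
    have hDa : 0 < 1 + a n / D := by have := ha0 n; positivity
    rw [div_le_iff₀ hDa]
    have h1 := lo n
    have : a n * (1 + (lambda1 Ω D (μs n) + M) / D)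
      = a n * (1 + M / D) + lambda1 Ω D (μs n) * (a n / D) := by ring
    linarith
  refine tendsto_of_tendsto_of_tendsto_of_le_of_le ?_ ?_ lo2 up
  · have h1 : Tendsto (fun n => (lambda1 Ω D μ - a n * (1 + M / D)) / (1 + a n / D)) atTop
        (nhds ((lambda1 Ω D μ - 0 * (1 + M / D)) / (1 + 0 / D))) :=
      (tendsto_const_nhds.sub (hat.mul_const _)).div (tendsto_const_nhds.add (hat.div_const _)) (by simp)
    simpa using h1
  · have h1 : Tendsto (fun n => lambda1 Ω D μ + a n * (1 + (lambda1 Ω D μ + M) / D)) atTop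
        (nhds (lambda1 Ω D μ + 0 * (1 + (lambda1 Ω D μ + M) / D))) :=
      tendsto_const_nhds.add (hat.mul_const _)
    simpa using h1
end

section
/- Let μ ∈ 𝓜, γ > 0, u_i ∈ 𝓓(ū,u̲) for some ū ≥ u̲ > 0, and let u_γ and v be classical solutions of (P_{μ,γ}) and (P_{μ,0}) with the same initial datum u_i. Then for all t ∈ [0,t₁] and all x in the closure of Ω, v(t,x) − u_γ(t,x) ≤ (γ ū² e^{2M t₁} / M)(e^{M t₁} − 1). -/
open MeasureTheory Real Set Filter

abbrev EE (d : ℕ) := EuclideanSpace ℝ (Fin d)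

lemma second_deriv_nonpos {φ : ℝ → ℝ} (hc : ContinuousAt φ 0) (hmax : IsLocalMax φ 0) :
    deriv (deriv φ) 0 ≤ 0 := by
  by_contra! h
  have h1 : deriv φ 0 = 0 := hmax.deriv_eq_zero
  have hmin : IsLocalMin φ 0 := isLocalMin_of_deriv_deriv_pos h h1 hc
  have he : φ =ᶠ[nhds 0] fun _ => φ 0 := by
    filter_upwards [hmax, hmin] with x h1 h2
    exact le_antisymm h1 h2
  have h2 : deriv φ =ᶠ[nhds 0] deriv (fun _ => φ 0) := he.deriv
  have h3 := h2.deriv_eq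
  simp at h3
  linarith

lemma fd_diff {d : ℕ} {f : EE d → ℝ} {x : EE d} (hf : ContDiffAt ℝ 2 f x) :
    DifferentiableAt ℝ (fderiv ℝ f) x :=
  (hf.fderiv_right (m := 1) (by norm_num)).differentiableAt (by norm_num)

lemma ev_diff {d : ℕ} {f : EE d → ℝ} {x : EE d} (hf : ContDiffAt ℝ 2 f x) :
    ∀ᶠ y in nhds x, DifferentiableAt ℝ f y := by
  have := hf.eventually (by simp)
  filter_upwards [this] with y hy using hy.differentiableAt (by norm_num)

lemma lap_comb {d : ℕ} {f g : EE d → ℝ} {x : EE d} (hf : ContDiffAt ℝ 2 f x)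
    (hg : ContDiffAt ℝ 2 g x) (a b c : ℝ) :
    lap (fun y => a * f y + b * g y + c) x = a * lap f x + b * lap g x := by
  unfold lap
  rw [Finset.mul_sum, Finset.mul_sum, ← Finset.sum_add_distrib]
  refine Finset.sum_congr rfl fun i _ => ?_
  set e : EE d := EuclideanSpace.single i 1
  have h1 : (fun y => fderiv ℝ (fun y => a * f y + b * g y + c) y e) =ᶠ[nhds x]
      fun y => a * fderiv ℝ f y e + b * fderiv ℝ g y e := by
    filter_upwards [ev_diff hf, ev_diff hg] with y h1 h2
    have : HasFDerivAt (fun y => a * f y + b * g y + c) (a • fderiv ℝ f y + b • fderiv ℝ g y) y :=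
      ((h1.hasFDerivAt.const_mul a).add (h2.hasFDerivAt.const_mul b)).add_const c
    rw [this.fderiv]; simp
  rw [h1.fderiv_eq]
  have hf' : DifferentiableAt ℝ (fun y => fderiv ℝ f y e) x :=
    (fd_diff hf).clm_apply (differentiableAt_const _)
  have hg' : DifferentiableAt ℝ (fun y => fderiv ℝ g y e) x :=
    (fd_diff hg).clm_apply (differentiableAt_const _)
  have := (hf'.hasFDerivAt.const_mul a).add (hg'.hasFDerivAt.const_mul b)
  have h2 := this.fderiv
  change fderiv ℝ (fun y => a * fderiv ℝ f y e + b * fderiv ℝ g y e) x = _ at h2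
  rw [h2]; simp

lemma lap_nonpos {d : ℕ} {f : EE d → ℝ} {x p : EE d} (hf : ContDiffAt ℝ 2 f x)
    (hm : IsLocalMax (fun y => f y - inner ℝ p y) x) : lap f x ≤ 0 := by
  unfold lap
  refine Finset.sum_nonpos fun i _ => ?_
  set e : EE d := EuclideanSpace.single i 1
  have hl : ∀ s : ℝ, HasDerivAt (fun s : ℝ => x + s • e) e s := fun s => by
    simpa using ((hasDerivAt_id s).smul_const e).const_add x
  have hl0 : ContinuousAt (fun s : ℝ => x + s • e) 0 := (hl 0).continuousAt
  have hx0 : x + (0:ℝ) • e = x := by simp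
  have htend : Tendsto (fun s : ℝ => x + s • e) (nhds 0) (nhds x) := by
    have := hl0.tendsto; rwa [hx0] at this
  set φ : ℝ → ℝ := fun s => f (x + s • e) - inner ℝ p (x + s • e) with hφ
  have hmax : IsLocalMax φ 0 := by
    have := htend.eventually hm
    filter_upwards [this] with s hs
    simpa [hφ, hx0] using hs
  have hd1 : deriv φ =ᶠ[nhds 0] fun s => fderiv ℝ f (x + s • e) e - inner ℝ p e := by
    filter_upwards [htend.eventually (ev_diff hf)] with s hs
    have h1 := hs.hasFDerivAt.comp_hasDerivAt s (hl s)
    have h2 := ((innerSL ℝ p).hasFDerivAt (x := x + s • e)).comp_hasDerivAt s (hl s)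
    exact (h1.sub h2).deriv
  have hc : ContinuousAt φ 0 := by
    have h1 : ContinuousAt (fun s : ℝ => f (x + s • e)) 0 := by
      apply ContinuousAt.comp (g := f) _ hl0
      rw [hx0]; exact hf.continuousAt
    exact h1.sub (by fun_prop)
  have hf' : DifferentiableAt ℝ (fun y => fderiv ℝ f y e) x :=
    (fd_diff hf).clm_apply (differentiableAt_const _)
  have key := second_deriv_nonpos hc hmax
  rw [hd1.deriv_eq] at key
  have h3 : HasDerivAt (fun s : ℝ => fderiv ℝ f (x + s • e) e - inner ℝ p e)
      (fderiv ℝ (fun y => fderiv ℝ f y e) x e) 0 := by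
    have h4 : HasFDerivAt (fun y => fderiv ℝ f y e) (fderiv ℝ (fun y => fderiv ℝ f y e) x)
      (x + (0:ℝ) • e) := by rw [hx0]; exact hf'.hasFDerivAt
    exact (h4.comp_hasDerivAt (0:ℝ) (hl 0)).sub_const _
  rwa [h3.deriv] at key

lemma deriv_left_bound {g : ℝ → ℝ} {d t κ : ℝ} (hg : HasDerivAt g d t) (hκ : 0 < κ) :
    ∀ᶠ s in nhds t, s ≤ t → g t - g s ≤ (d + κ) * (t - s) := by
  have h := hg.isLittleO.def hκ
  filter_upwards [h] with s hs hst
  rw [Real.norm_eq_abs, Real.norm_eq_abs, abs_of_nonpos (sub_nonpos.2 hst), smul_eq_mul] at hs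
  have := (abs_le.1 hs).1
  nlinarith

lemma oneD {f : ℝ → ℝ} {T a : ℝ} (hT : 0 < T) (hf : Continuous f) (h0 : f 0 ≤ a) {E : Set ℝ}
    (hE : volume E = 0)
    (h : ∀ t ∈ Ioc 0 T, a < f t → ∃ (g : ℝ → ℝ) (d : ℝ), HasDerivAt g d t ∧
      (∀ s ∈ Icc 0 t, f t - f s ≤ g t - g s) ∧ (t ∉ E → d ≤ 0)) : f T ≤ a := by
  by_contra! hcon
  set c := f T - a with hc
  have hc0 : 0 < c := by linarith
  set E' := toMeasurable volume E
  have hE'm : MeasurableSet E' := measurableSet_toMeasurable _ _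
  have hE' : volume E' = 0 := by rw [measure_toMeasurable, hE]
  obtain ⟨g, hg1, hg2, hg3⟩ := exists_le_lowerSemicontinuous_lintegral_ge volume
    (E'.indicator (fun _ => (⊤ : ENNReal))) (measurable_const.indicator hE'm)
    (ε := ENNReal.ofReal (c / 4)) (by simp; linarith)
  have hint0 : ∫⁻ x, E'.indicator (fun _ => (⊤ : ENNReal)) x = 0 := by
    rw [lintegral_indicator hE'm]; simp [hE']
  rw [hint0, zero_add] at hg3
  have hgm : Measurable g := hg2.measurable
  have hgfin : ∫⁻ x, g x ≠ ⊤ := ne_top_of_le_ne_top ENNReal.ofReal_ne_top hg3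
  have hgi : Integrable (fun x => (g x).toReal) :=
    integrable_toReal_of_lintegral_ne_top hgm.aemeasurable hgfin
  have hgae : ∀ᵐ x, g x < ⊤ := ae_lt_top hgm hgfin
  have hii : ∀ a b, IntervalIntegrable (fun x => (g x).toReal) volume a b :=
    fun a b => hgi.intervalIntegrable
  set ψ : ℝ → ℝ := fun t => ∫ s in (0:ℝ)..t, (g s).toReal with hψ
  have hψc : Continuous ψ := intervalIntegral.continuous_primitive hii 0
  have hψd : ∀ s t, ψ t - ψ s = ∫ r in s..t, (g r).toReal := fun s t =>
    intervalIntegral.integral_interval_sub_left (hii _ _) (hii _ _)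
  have hψm : ∀ s t, s ≤ t → ψ s ≤ ψ t := fun s t hst => by
    have := hψd s t
    have h2 : 0 ≤ ∫ r in s..t, (g r).toReal :=
      intervalIntegral.integral_nonneg hst (fun _ _ => ENNReal.toReal_nonneg)
    linarith
  have hψ0 : ψ 0 = 0 := by simp [hψ]
  have hψT : ψ T ≤ c / 4 := by
    have h1 : ψ T ≤ ∫ x, (g x).toReal := by
      rw [hψ]; simp only
      rw [intervalIntegral.integral_of_le hT.le]
      exact setIntegral_le_integral hgi (ae_of_all _ fun _ => ENNReal.toReal_nonneg)
    rw [integral_toReal hgm.aemeasurable hgae] at h1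
    refine h1.trans ?_
    exact ENNReal.toReal_le_of_le_ofReal (by linarith) hg3
  set ε := c / (4 * T) with hε
  have hε0 : 0 < ε := by positivity
  have hεT : ε * T = c / 4 := by rw [hε]; field_simp
  set H : ℝ → ℝ := fun t => f t - ψ t - ε * t with hH
  have hHc : Continuous H := by fun_prop
  have hHT : a < H T := by simp only [hH]; linarith
  set S := Icc 0 T ∩ {t | H T ≤ H t} with hS
  have hSc : IsCompact S := isCompact_Icc.inter_right (isClosed_le continuous_const hHc)
  obtain ⟨τ, hτS, hτ⟩ := hSc.exists_isLeast ⟨T, ⟨hT.le, le_rfl⟩, le_refl (H T)⟩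
  have hτH : H T ≤ H τ := hτS.2
  have hτ0 : 0 < τ := by
    rcases hτS.1.1.eq_or_lt with h | h
    · exfalso
      rw [← h] at hτH
      simp only [hH] at hτH hHT
      rw [hψ0] at hτH
      linarith
    · exact h
  have hfτ : a < f τ := by
    have := hψm 0 τ hτ0.le
    have h2 : 0 ≤ ε * τ := by positivity
    simp only [hH] at hτH hHT
    linarith
  obtain ⟨q, d, hq, hqf, hqE⟩ := h τ ⟨hτ0, hτS.1.2⟩ hfτ
  have key : ∀ᶠ s in nhdsWithin τ (Iio τ), f τ - f s ≤ ψ τ - ψ s + ε * (τ - s) := by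
    have hpos : ∀ᶠ s in nhdsWithin τ (Iio τ), 0 < s :=
      nhdsWithin_le_nhds (lt_mem_nhds hτ0)
    have hd := nhdsWithin_le_nhds (s := Iio τ) (deriv_left_bound hq hε0)
    by_cases hτE : τ ∈ E
    · have hgτ : g τ = ⊤ := by
        have := hg1 τ
        rw [indicator_of_mem (subset_toMeasurable _ _ hτE)] at this
        exact top_le_iff.1 this
      have hl := hg2 τ (ENNReal.ofReal d) (by show _ < g τ; rw [hgτ]; exact ENNReal.ofReal_lt_top)
      rw [Metric.eventually_nhds_iff] at hl
      obtain ⟨r, hr, hl⟩ := hl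
      have hrr : ∀ᶠ s in nhdsWithin τ (Iio τ), τ - r < s :=
        nhdsWithin_le_nhds (lt_mem_nhds (by linarith))
      filter_upwards [hpos, hd, hrr, self_mem_nhdsWithin] with s h1 h2 h3 h4
      have h4 : s < τ := h4
      have h5 := hqf s ⟨h1.le, h4.le⟩
      have h6 := h2 h4.le
      have h7 : d * (τ - s) ≤ ψ τ - ψ s := by
        rw [hψd]
        have : ∫ r in s..τ, d = d * (τ - s) := by simp [mul_comm]
        rw [← this]
        refine intervalIntegral.integral_mono_ae_restrict h4.le (by simp) (hii _ _) ?_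
        filter_upwards [ae_restrict_of_ae hgae, ae_restrict_mem measurableSet_Icc] with y hy hy2
        have h8 : ENNReal.ofReal d < g y := hl (by
          rw [Real.dist_eq, abs_lt]; constructor <;> linarith [hy2.1, hy2.2])
        exact (ENNReal.ofReal_le_iff_le_toReal hy.ne).1 h8.le
      linarith
    · have := hqE hτE
      filter_upwards [hpos, hd, self_mem_nhdsWithin] with s h1 h2 h4
      have h4 : s < τ := h4
      have h5 := hqf s ⟨h1.le, h4.le⟩
      have h6 := h2 h4.le
      have h7 := hψm s τ h4.le
      nlinarith
  have hpos : ∀ᶠ s in nhdsWithin τ (Iio τ), 0 < s :=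
      nhdsWithin_le_nhds (lt_mem_nhds hτ0)
  obtain ⟨s, h1, h2, h3⟩ := (key.and (hpos.and self_mem_nhdsWithin)).exists
  have h3 : s < τ := h3
  have : τ ≤ s := hτ ⟨⟨h2.le, h3.le.trans hτS.1.2⟩, by
    simp only [hH, mem_ofPred_eq] at hτH ⊢
    linarith⟩
  linarith

lemma core {d : ℕ} {Ω N : Set (EE d)} (hΩo : IsOpen Ω) (hΩb : Bornology.IsBounded Ω)
    (hN : volume N = 0) {D T : ℝ} (hD : 0 < D) (hT : 0 < T) {W : ℝ → EE d → ℝ}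
    (hc : ContinuousOn (fun p : ℝ × EE d => W p.1 p.2) (Icc (0:ℝ) T ×ˢ closure Ω))
    (ht : ∀ t ∈ Ioc 0 T, ∀ x ∈ Ω, DifferentiableAt ℝ (fun s => W s x) t)
    (hx : ∀ t ∈ Ioc 0 T, ∀ x ∈ Ω, ContDiffAt ℝ 2 (W t) x)
    (heq : ∀ t ∈ Ioc 0 T, ∀ x ∈ Ω, x ∉ N → 0 < W t x →
      deriv (fun s => W s x) t ≤ D * lap (W t) x)
    (hb : ∀ t ∈ Ioc 0 T, ∀ x ∈ frontier Ω, W t x ≤ 0)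
    (h0 : ∀ x ∈ closure Ω, W 0 x ≤ 0) : ∀ x ∈ closure Ω, W T x ≤ 0 := by
  intro x₀ hx₀
  by_contra! hη
  set η := W T x₀ with hηdef
  have hK : IsCompact (closure Ω) := hΩb.isCompact_closure
  have : CompactSpace (closure Ω) := isCompact_iff_compactSpace.1 hK
  have : Nonempty (closure Ω) := ⟨⟨x₀, hx₀⟩⟩
  obtain ⟨R, hR0, hR⟩ : ∃ R > 0, ∀ x ∈ closure Ω, ‖x‖ ≤ R := hK.isBounded.exists_pos_norm_le
  set cl : ℝ → ℝ := fun t => max 0 (min T t) with hcl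
  have hclc : Continuous cl := by fun_prop
  have hcl_mem : ∀ t, cl t ∈ Icc 0 T := fun t => ⟨le_max_left _ _, max_le hT.le (min_le_left _ _)⟩
  have hcl_eq : ∀ t ∈ Icc 0 T, cl t = t := fun t h => by
    simp only [hcl]; rw [min_eq_right h.2, max_eq_right h.1]
  set F : (ℝ × EE d) → closure Ω → ℝ := fun q x => W (cl q.1) x - inner ℝ q.2 (x : EE d) with hF
  have hFc : Continuous (fun z : (ℝ × EE d) × closure Ω => F z.1 z.2) := by
    have h1 : Continuous (fun z : (ℝ × EE d) × closure Ω => W (cl z.1.1) z.2) :=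
      hc.comp_continuous (f := fun z : (ℝ × EE d) × closure Ω => (cl z.1.1, (z.2 : EE d)))
        (by fun_prop) (fun z => ⟨hcl_mem _, z.2.2⟩)
    exact h1.sub (by fun_prop)
  set Mx : ℝ → EE d → ℝ := fun t p => sSup (F (t, p) '' univ) with hMx
  have hMc : Continuous (Function.uncurry Mx) := by
    have := isCompact_univ.continuous_sSup (f := F) hFc
    exact this
  have hFc1 : ∀ q, Continuous (F q) := fun q => hFc.comp (by fun_prop : Continuous fun x => (q, x))
  have hMle : ∀ t p, ∀ x : closure Ω, F (t, p) x ≤ Mx t p := fun t p x =>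
    le_csSup (isCompact_univ.image (hFc1 _)).bddAbove ⟨x, mem_univ _, rfl⟩
  have hMex : ∀ t p, ∃ x : closure Ω, Mx t p = F (t, p) x := fun t p => by
    obtain ⟨x, -, hx⟩ := isCompact_univ.exists_sSup_image_eq univ_nonempty (hFc1 (t, p)).continuousOn
    exact ⟨x, hx⟩
  have hin : ∀ p : EE d, ∀ x ∈ closure Ω, |inner ℝ p x| ≤ ‖p‖ * R := fun p x hx =>
    (abs_real_inner_le_norm p x).trans (mul_le_mul_of_nonneg_left (hR x hx) (norm_nonneg _))
  have hLip : ∀ t, LipschitzWith R.toNNReal (Mx t) := fun t => by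
    refine LipschitzWith.of_le_add_mul _ fun p q => ?_
    obtain ⟨x, hx⟩ := hMex t p
    have h1 := hMle t q x
    have h2 := hin (p - q) x x.2
    rw [inner_sub_left] at h2
    have h3 := (abs_le.1 h2).1
    rw [hx, Real.coe_toNNReal _ hR0.le, dist_eq_norm]
    simp only [hF] at h1 ⊢
    linarith
  -- gradient identification
  have hgrad : ∀ t p, DifferentiableAt ℝ (Mx t) p → ∀ x : closure Ω, Mx t p = F (t, p) x →
      -gradient (Mx t) p = (x : EE d) := by
    intro t p hd x hx
    have hmin : IsLocalMin (fun q => Mx t q + inner ℝ (x : EE d) q) p := by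
      refine Filter.Eventually.of_forall fun q => ?_
      have h1 := hMle t q x
      simp only
      rw [hx]
      simp only [hF] at h1 ⊢
      rw [real_inner_comm p, real_inner_comm q]
      linarith
    have h1 : HasFDerivAt (fun q => Mx t q + inner ℝ (x : EE d) q)
        (fderiv ℝ (Mx t) p + innerSL ℝ (x : EE d)) p :=
      hd.hasFDerivAt.add (innerSL ℝ (x : EE d)).hasFDerivAt
    have h2 := hmin.hasFDerivAt_eq_zero h1
    have h3 : fderiv ℝ (Mx t) p = InnerProductSpace.toDual ℝ (EE d) (-(x : EE d)) := by
      ext y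
      have := congrArg (fun L => L y) h2
      simp at this ⊢
      linarith
    rw [gradient, h3]; simp
  -- interior maximizers
  have hlocmax : ∀ t ∈ Ioc 0 T, ∀ p, ∀ x : closure Ω, Mx t p = F (t, p) x → (x : EE d) ∈ Ω →
      IsLocalMax (fun y => W t y - inner ℝ p y) (x : EE d) := by
    intro t htT p x hx hxΩ
    filter_upwards [hΩo.mem_nhds hxΩ] with y hy
    have h1 := hMle t p ⟨y, subset_closure hy⟩
    rw [hx] at h1
    simp only [hF, hcl_eq t ⟨htT.1.le, htT.2⟩] at h1
    exact h1
  set N' := toMeasurable volume N ∩ Ω with hN'def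
  have hN'm : MeasurableSet N' := (measurableSet_toMeasurable _ _).inter hΩo.measurableSet
  have hN'0 : volume N' = 0 := measure_mono_null inter_subset_left
    (by rw [measure_toMeasurable, hN])
  set Good : ℝ → EE d → Prop := fun t p => DifferentiableAt ℝ (Mx t) p ∧ -gradient (Mx t) p ∉ N'
    with hGood
  have hGm : MeasurableSet {z : ℝ × EE d | Good z.1 z.2} := by
    refine (measurableSet_of_differentiableAt_with_param ℝ hMc).inter ?_
    have h1 : Measurable (fun z : ℝ × EE d => -gradient (Mx z.1) z.2) := by
      have := measurable_fderiv_with_param ℝ hMc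
      exact (((InnerProductSpace.toDual ℝ (EE d)).symm.continuous.measurable).comp this).neg
    exact (h1 hN'm).compl
  have hG1 : ∀ t ∈ Ioc 0 T, ∀ᵐ p, Good t p := by
    intro t htT
    have hnull : volume ((fun y => gradient (W t) y) '' N') = 0 := by
      refine addHaar_image_eq_zero_of_differentiableOn_of_addHaar_eq_zero volume ?_ hN'0
      intro y hy
      have h1 := fd_diff (hx t htT y hy.2)
      exact ((InnerProductSpace.toDual ℝ (EE d)).symm.differentiable.differentiableAt.comp y
        h1).differentiableWithinAt
    filter_upwards [(hLip t).ae_differentiableAt (μ := volume), measure_eq_zero_iff_ae_notMem.1 hnull]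
      with p h1 h2
    refine ⟨h1, fun h3 => h2 ?_⟩
    obtain ⟨x, hxm⟩ := hMex t p
    rw [hgrad t p h1 x hxm] at h3
    refine ⟨x, h3, ?_⟩
    have hlm := hlocmax t htT p x hxm h3.2
    have hd := ((hx t htT x h3.2).differentiableAt (by norm_num)).hasFDerivAt
    have h4 := hlm.hasFDerivAt_eq_zero (hd.sub (innerSL ℝ p).hasFDerivAt)
    simp only [gradient]
    rw [LinearIsometryEquiv.symm_apply_eq]
    rw [sub_eq_zero.1 h4]
    ext y; simp
  have hG2 : ∀ᵐ p, ∀ᵐ t ∂(volume.restrict (Ioc 0 T)), Good t p := by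
    rw [← Measure.ae_ae_comm hGm]
    filter_upwards [ae_restrict_mem measurableSet_Ioc] with t ht using hG1 t ht
  obtain ⟨p, hpG, hpδ⟩ : ∃ p : EE d, (∀ᵐ t ∂(volume.restrict (Ioc 0 T)), Good t p) ∧
      ‖p‖ < η / (4 * R) := by
    by_contra! hcon
    have h1 : volume (Metric.ball (0 : EE d) (η / (4 * R))) = 0 := by
      rw [measure_eq_zero_iff_ae_notMem]
      filter_upwards [hG2] with p hp
      simpa using hcon p hp
    have h2 := Metric.measure_ball_pos volume (0 : EE d) (by positivity : 0 < η / (4 * R))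
    exact h2.ne' h1
  have hpR : ‖p‖ * R ≤ η / 4 := by
    have := mul_le_mul_of_nonneg_right hpδ.le hR0.le
    have h2 : η / (4 * R) * R = η / 4 := by field_simp
    linarith
  have hin' : ∀ x ∈ closure Ω, |inner ℝ p x| ≤ η / 4 := fun x hx => (hin p x hx).trans hpR
  rw [ae_restrict_iff' measurableSet_Ioc] at hpG
  have hE : volume {t | ¬ (t ∈ Ioc 0 T → Good t p)} = 0 := hpG
  have hfin := oneD (f := fun t => Mx t p) (a := η / 4) hT
    (hMc.comp (by fun_prop : Continuous fun t : ℝ => (t, p))) ?_ hE ?_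
  · have h1 := hMle T p ⟨x₀, hx₀⟩
    simp only [hF, hcl_eq T ⟨hT.le, le_rfl⟩] at h1
    have h2 := abs_le.1 (hin' x₀ hx₀)
    linarith [h2.2]
  · obtain ⟨x, hxm⟩ := hMex 0 p
    rw [hxm]
    simp only [hF, hcl_eq 0 ⟨le_rfl, hT.le⟩]
    linarith [h0 x x.2, (abs_le.1 (hin' x x.2)).1]
  · intro t htT hgt
    obtain ⟨x, hxm⟩ := hMex t p
    have hclt := hcl_eq t ⟨htT.1.le, htT.2⟩
    have hWpos : 0 < W t x := by
      rw [hxm] at hgt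
      simp only [hF, hclt] at hgt
      linarith [(abs_le.1 (hin' x x.2)).1]
    have hxΩ : (x : EE d) ∈ Ω := by
      by_contra hno
      have : (x : EE d) ∈ frontier Ω := by
        rw [hΩo.frontier_eq]; exact ⟨x.2, hno⟩
      linarith [hb t htT x this]
    refine ⟨fun s => W s x, _, (ht t htT x hxΩ).hasDerivAt, ?_, ?_⟩
    · intro s hs
      have h1 := hMle s p x
      simp only
      rw [hxm]
      simp only [hF, hclt, hcl_eq s ⟨hs.1, hs.2.trans htT.2⟩] at h1 ⊢
      linarith
    · intro htE
      have hgood : Good t p := by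
        simp only [mem_ofPred_eq, not_not] at htE
        exact htE htT
      have hxN : (x : EE d) ∉ N := fun hxN => by
        apply hgood.2
        rw [hgrad t p hgood.1 x hxm]
        exact ⟨subset_toMeasurable _ _ hxN, hxΩ⟩
      have h1 := heq t htT x hxΩ hxN hWpos
      have h2 := lap_nonpos (hx t htT x hxΩ) (hlocmax t htT p x hxm hxΩ)
      nlinarith

lemma comparison {d : ℕ} {Ω N : Set (EE d)} (hΩo : IsOpen Ω) (hΩb : Bornology.IsBounded Ω)
    (hN : volume N = 0) {D T : ℝ} (hD : 0 < D) {w : ℝ → EE d → ℝ} {K C A : ℝ}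
    (hK : 0 < K) (hC : 0 ≤ C) (hA : 0 ≤ A)
    (hc : ContinuousOn (fun p : ℝ × EE d => w p.1 p.2) (Icc (0:ℝ) T ×ˢ closure Ω))
    (ht : ∀ t ∈ Ioc 0 T, ∀ x ∈ Ω, DifferentiableAt ℝ (fun s => w s x) t)
    (hx : ∀ t ∈ Ioc 0 T, ∀ x ∈ Ω, ContDiffAt ℝ 2 (w t) x)
    (heq : ∀ t ∈ Ioc 0 T, ∀ x ∈ Ω, x ∉ N → 0 < w t x →
      deriv (fun s => w s x) t ≤ D * lap (w t) x + K * w t x + C)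
    (hb : ∀ t ∈ Ioc 0 T, ∀ x ∈ frontier Ω, w t x ≤ 0)
    (h0 : ∀ x ∈ closure Ω, w 0 x ≤ A) : ∀ t ∈ Icc 0 T, ∀ x ∈ closure Ω,
      w t x ≤ A * exp (K * t) + C / K * (exp (K * t) - 1) := by
  intro t htT x hxc
  rcases htT.1.eq_or_lt with h | htpos
  · rw [← h]; simpa using h0 x hxc
  have hsub : Ioc 0 t ⊆ Ioc 0 T := Ioc_subset_Ioc_right htT.2
  have hCK : 0 ≤ C / K := by positivity
  have hCK' : C / K * K = C := by field_simp
  have hexp1 : ∀ s ∈ Ioc 0 t, exp (-(K * s)) ≤ 1 := fun s hs => by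
    rw [exp_le_one_iff]; nlinarith [hs.1]
  have key := core (W := fun s y => exp (-(K * s)) * w s y + 0 * w s y +
      (exp (-(K * s)) * (C / K) - (A + C / K))) hΩo hΩb hN hD htpos ?_ ?_ ?_ ?_ ?_ ?_ x hxc
  · have h1 : exp (K * t) * exp (-(K * t)) = 1 := by rw [← exp_add]; simp
    have h2 := mul_le_mul_of_nonneg_left key (exp_pos (K * t)).le
    have h3 : exp (K * t) * (exp (-(K * t)) * w t x + 0 * w t x +
      (exp (-(K * t)) * (C / K) - (A + C / K))) = (exp (K * t) * exp (-(K * t))) * (w t x + C / K)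
        - exp (K * t) * (A + C / K) := by ring
    rw [h3, h1] at h2
    linarith
  · have hc' : ContinuousOn (fun p : ℝ × EE d => w p.1 p.2) (Icc (0:ℝ) t ×ˢ closure Ω) :=
      hc.mono (prod_mono (Icc_subset_Icc_right htT.2) subset_rfl)
    have he : ContinuousOn (fun p : ℝ × EE d => exp (-(K * p.1))) (Icc (0:ℝ) t ×ˢ closure Ω) := by
      fun_prop
    exact ((he.mul hc').add (continuousOn_const.mul hc')).add
      ((he.mul continuousOn_const).sub continuousOn_const)
  · intro s hs y hy
    have := ht s (hsub hs) y hy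
    fun_prop
  · intro s hs y hy
    have := hx s (hsub hs) y hy
    fun_prop
  · intro s hs y hy hyN hpos
    have hxs := hx s (hsub hs) y hy
    rw [lap_comb hxs hxs]
    have he := exp_pos (-(K * s))
    have he1 := hexp1 s hs
    have hw : 0 < w s y := by
      by_contra! hle
      nlinarith
    have h1 := heq s (hsub hs) y hy hyN hw
    have hde : HasDerivAt (fun s => exp (-(K * s))) (exp (-(K * s)) * (-K)) s := by
      have : HasDerivAt (fun s => -(K * s)) (-K) s := by
        simpa using (hasDerivAt_id s).const_mul (-K)
      exact this.exp
    have hdw := (ht s (hsub hs) y hy).hasDerivAt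
    have hdW : HasDerivAt (fun s => exp (-(K * s)) * w s y + 0 * w s y +
      (exp (-(K * s)) * (C / K) - (A + C / K))) _ s :=
      ((hde.mul hdw).add (hdw.const_mul 0)).add ((hde.mul_const (C / K)).sub_const _)
    rw [hdW.deriv]
    have h2 := mul_le_mul_of_nonneg_left h1 he.le
    have h3 : exp (-(K * s)) * -K * (C / K) = - (exp (-(K * s)) * C) := by
      rw [← hCK']; field_simp
    rw [h3]
    linarith
  · intro s hs y hy
    have h1 := hb s (hsub hs) y hy
    have he := exp_pos (-(K * s))
    have he1 := hexp1 s hs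
    nlinarith
  · intro y hy
    simpa using by linarith [h0 y hy]

/-- Bound on the gap between nonlinear and linear solutions:
`v - u_γ ≤ (γ ū² e^{2M t₁}/M)(e^{M t₁} - 1)` on `[0,t₁] × closure Ω`. -/
theorem stmt_13 {d : ℕ} (hd : 1 ≤ d)
    (Ω Ω₁ Bε : Set (EuclideanSpace ℝ (Fin d)))
    (hΩo : IsOpen Ω) (hΩb : Bornology.IsBounded Ω) (hΩne : Ω.Nonempty)
    (hΩ₁ : IsCompact Ω₁) (hΩ₁Ω : Ω₁ ⊆ Ω)
    (hB : ∃ c ε, 0 < ε ∧ Bε = Metric.closedBall c ε) (hBΩ₁ : Bε ⊆ Ω₁)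
    (D m M : ℝ) (hD : 0 < D) (hM : 0 < M)
    (t₀ t₁ : ℝ) (ht₀ : 0 < t₀) (ht₀₁ : t₀ < t₁)
    (γ : ℝ) (hγ : 0 < γ)
    (ubar lbar : ℝ) (hl : 0 < lbar) (hul : lbar ≤ ubar)
    (μ ui : EuclideanSpace ℝ (Fin d) → ℝ)
    (hμ : MemM Ω Ω₁ m M μ) (hui : MemD Ω Bε ubar lbar ui)
    (uγ v : ℝ → EuclideanSpace ℝ (Fin d) → ℝ)
    (huγ : IsSol Ω D γ μ ui uγ) (hv : IsSol Ω D 0 μ ui v) :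
    ∀ t ∈ Icc (0:ℝ) t₁, ∀ x ∈ closure Ω,
      v t x - uγ t x ≤ (γ * ubar^2 * Real.exp (2 * M * t₁) / M) *
        (Real.exp (M * t₁) - 1) := by
  obtain ⟨hμm, hμb, -⟩ := hμ
  obtain ⟨-, hui0, huib, -⟩ := hui
  obtain ⟨uc, ut, ux, ueq, ub, u0⟩ := huγ
  obtain ⟨vc, vt, vx, veq, vb, v0⟩ := hv
  set N : Set (EuclideanSpace ℝ (Fin d)) := {x | ¬ (x ∈ Ω → -M ≤ μ x ∧ μ x ≤ M)} with hNdef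
  have hN : volume N = 0 := hμb
  have hNμ : ∀ x ∈ Ω, x ∉ N → -M ≤ μ x ∧ μ x ≤ M := fun x hx hxN => by
    by_contra hcon
    exact hxN (fun h => hcon (h hx))
  have hub : 0 ≤ ubar := by linarith
  have ht₁ : 0 < t₁ := ht₀.trans ht₀₁
  have hsub : Icc (0:ℝ) t₁ ×ˢ closure Ω ⊆ Ici (0:ℝ) ×ˢ closure Ω :=
    prod_mono Icc_subset_Ici_self subset_rfl
  have uc' := uc.mono hsub
  have vc' := vc.mono hsub
  -- upper bound for the nonlinear solution
  have hup : ∀ t ∈ Icc 0 t₁, ∀ x ∈ closure Ω, uγ t x ≤ ubar * exp (M * t) := by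
    have := comparison (T := t₁) (w := uγ) (K := M) (C := 0) (A := ubar) hΩo hΩb hN hD hM le_rfl hub
      uc' (fun t ht => ut t ht.1) (fun t ht => ux t ht.1) ?_
      (fun t ht x hx => (ub t ht.1 x hx).le)
      (fun x hx => by rw [u0 x hx]; exact (le_abs_self _).trans (huib x hx).1)
    · simpa using this
    · intro t ht x hx hxN hpos
      rw [ueq t ht.1 x hx]
      have h1 := (hNμ x hx hxN).2
      have h2 : 0 < γ * uγ t x := mul_pos hγ hpos
      nlinarith
  -- nonnegativity
  have hK : IsCompact (Icc (0:ℝ) t₁ ×ˢ closure Ω) := isCompact_Icc.prod hΩb.isCompact_closure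
  obtain ⟨B, hB0, hBd⟩ : ∃ B > 0, ∀ t ∈ Icc 0 t₁, ∀ x ∈ closure Ω, |uγ t x| ≤ B := by
    obtain ⟨B, hB⟩ := hK.exists_bound_of_continuousOn uc'
    exact ⟨max B 1, by positivity, fun t ht x hx => (hB (t, x) ⟨ht, hx⟩).trans (le_max_left _ _)⟩
  have hnn : ∀ t ∈ Icc 0 t₁, ∀ x ∈ closure Ω, 0 ≤ uγ t x := by
    have := comparison (T := t₁) (w := fun t x => (-1) * uγ t x + 0 * uγ t x + 0) (K := M + γ * B)
      (C := 0) (A := 0) hΩo hΩb hN hD (by positivity) le_rfl le_rfl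
      ((continuousOn_const.mul uc').add (continuousOn_const.mul uc') |>.add continuousOn_const)
      (fun t ht x hx => by have := ut t ht.1 x hx; fun_prop)
      (fun t ht x hx => by have := ux t ht.1 x hx; fun_prop) ?_
      (fun t ht x hx => by simp [ub t ht.1 x hx])
      (fun x hx => by simpa [u0 x hx] using hui0 x hx)
    · intro t ht x hx
      have := this t ht x hx
      simp at this
      exact this
    · intro t ht x hx hxN hpos
      have hxs := ux t ht.1 x hx
      rw [lap_comb hxs hxs]
      have hdd : HasDerivAt (fun s => (-1) * uγ s x + 0 * uγ s x + 0) _ t :=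
        ((((ut t ht.1 x hx).hasDerivAt.const_mul (-1)).add
          ((ut t ht.1 x hx).hasDerivAt.const_mul 0)).add_const 0)
      rw [hdd.deriv, ueq t ht.1 x hx]
      have h1 := (hNμ x hx hxN).2
      have h2 := (abs_le.1 (hBd t ⟨ht.1.le, ht.2⟩ x (subset_closure hx))).1
      have h3 : μ x - γ * uγ t x ≤ M + γ * B := by nlinarith
      have h4 : 0 < - uγ t x := by linarith
      have h5 := mul_le_mul_of_nonneg_left h3 h4.le
      linarith
  -- the difference
  set C := γ * ubar ^ 2 * exp (2 * M * t₁) with hCdef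
  have hC : 0 ≤ C := by positivity
  have hfin := comparison (T := t₁) (w := fun t x => 1 * v t x + (-1) * uγ t x + 0) (K := M)
      (C := C) (A := 0) hΩo hΩb hN hD hM hC le_rfl
      ((continuousOn_const.mul vc').add (continuousOn_const.mul uc') |>.add continuousOn_const)
      (fun t ht x hx => by have := ut t ht.1 x hx; have := vt t ht.1 x hx; fun_prop)
      (fun t ht x hx => by have := ux t ht.1 x hx; have := vx t ht.1 x hx; fun_prop) ?_
      (fun t ht x hx => by simp [ub t ht.1 x hx, vb t ht.1 x hx])
      (fun x hx => by simp [u0 x hx, v0 x hx])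
  · intro t ht x hx
    have h1 := hfin t ht x hx
    have h2 : exp (M * t) ≤ exp (M * t₁) := exp_le_exp.2 (by nlinarith [ht.2])
    have h3 : C / M * (exp (M * t) - 1) ≤ C / M * (exp (M * t₁) - 1) :=
      mul_le_mul_of_nonneg_left (by linarith) (by positivity)
    linarith
  · intro t ht x hx hxN hpos
    rw [lap_comb (vx t ht.1 x hx) (ux t ht.1 x hx)]
    have hdd : HasDerivAt (fun s => 1 * v s x + (-1) * uγ s x + 0) _ t :=
        ((((vt t ht.1 x hx).hasDerivAt.const_mul 1).add
          ((ut t ht.1 x hx).hasDerivAt.const_mul (-1))).add_const 0)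
    rw [hdd.deriv, ueq t ht.1 x hx, veq t ht.1 x hx]
    have h1 := (hNμ x hx hxN).2
    have htI : t ∈ Icc 0 t₁ := ⟨ht.1.le, ht.2⟩
    have h2 := hup t htI x (subset_closure hx)
    have h3 := hnn t htI x (subset_closure hx)
    have h4 : γ * uγ t x ^ 2 ≤ C := by
      have h5 : uγ t x ≤ ubar * exp (M * t₁) := h2.trans
        (mul_le_mul_of_nonneg_left (exp_le_exp.2 (by nlinarith [ht.2])) hub)
      have h6 : uγ t x ^ 2 ≤ (ubar * exp (M * t₁)) ^ 2 := pow_le_pow_left₀ h3 h5 2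
      have h7 : exp (2 * M * t₁) = exp (M * t₁) ^ 2 := by
        rw [← exp_nat_mul]; congr 1; push_cast; ring
      rw [hCdef, h7, mul_assoc, ← mul_pow]
      exact mul_le_mul_of_nonneg_left h6 hγ.le
    have h8 : 0 < v t x - uγ t x := by linarith
    nlinarith [mul_le_mul_of_nonneg_left h1 h8.le]
end
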